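/- Let q, a, b, t be complex numbers with |q| < 1 such that a·t·q^k ≠ 1 and b·t·q^k ≠ 1 for every integer k ≥ 1. Then ( (atq;q)_∞ / (q;q)_∞ ) · Σ_{k=0}^{∞} (−bt)^k q^{k(k+1)/2} / ( (q;q)_k (atq;q)_k ) = ( (atq;q)_∞ (btq;q)_∞ / (q;q)_∞ ) · Σ_{k=0}^{∞} (−1)^k (a b t² q)^k q^{k(3k−1)/2} / ( (atq;q)_k (btq;q)_k (q;q)_k ), where all series converge absolutely under these hypotheses. -/

import Mathlib

open scoped BigOperators

/-- The finite q-Pochhammer symbol `(a;q)_n = ∏_{i=0}^{n-1} (1 - a q^i)`. -/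
noncomputable def qPoch (a q : ℂ) (n : ℕ) : ℂ := ∏ i ∈ Finset.range n, (1 - a * q ^ i)

/-- The infinite q-Pochhammer symbol `(a;q)_∞ = ∏_{i=0}^{∞} (1 - a q^i)`. -/
noncomputable def qPochInf (a q : ℂ) : ℂ := ∏' i : ℕ, (1 - a * q ^ i)

open Filter Topology
open Finset.HasAntidiagonal (antidiagonal mem_antidiagonal)

lemma triangle_add (k m : ℕ) :
    (k + m) * (k + m + 1) / 2 = k * (k + 1) / 2 + m * (m + 1) / 2 + k * m := by
  obtain ⟨c, hc⟩ := even_iff_two_dvd.mp (Nat.even_mul_succ_self k)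
  obtain ⟨d, hd⟩ := even_iff_two_dvd.mp (Nat.even_mul_succ_self m)
  have h : (k + m) * (k + m + 1) = 2 * (c + d + k * m) := by
    linear_combination hc + hd
  rw [h, hc, hd]
  simp

lemma triangle_succ (k : ℕ) : (k + 1) * (k + 1 + 1) / 2 = k * (k + 1) / 2 + (k + 1) := by
  rw [triangle_add k 1]
  omega

lemma pentagonal_add_self (k : ℕ) :
    k * (3 * k - 1) / 2 + k = k * k + k * (k + 1) / 2 := by
  obtain ⟨c, hc⟩ := even_iff_two_dvd.mp (Nat.even_mul_succ_self k)
  rcases k with _ | k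
  · rfl
  · have h : (k + 1) * (3 * (k + 1) - 1) + 2 * (k + 1) = 2 * ((k + 1) * (k + 1) + c) := by
      rw [show 3 * (k + 1) - 1 = 3 * k + 2 by omega]
      linear_combination hc
    rw [hc]
    omega

lemma qPoch_zero (a q : ℂ) : qPoch a q 0 = 1 := by simp [qPoch]

lemma qPoch_succ (a q : ℂ) (n : ℕ) : qPoch a q (n + 1) = qPoch a q n * (1 - a * q ^ n) :=
  Finset.prod_range_succ _ _

lemma qPoch_succ' (a q : ℂ) (n : ℕ) : qPoch a q (n + 1) = (1 - a) * qPoch (a * q) q n := by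
  simp only [qPoch, Finset.prod_range_succ', pow_succ', pow_zero, mul_one, mul_assoc]
  rw [mul_comm]

lemma one_sub_mul_pow_ne_zero {x q : ℂ} (hx : ∀ k : ℕ, 1 ≤ k → x * q ^ k ≠ 1) (n : ℕ) :
    1 - x * q * q ^ n ≠ 0 := by
  have := hx (n + 1) (by omega)
  rw [pow_succ', ← mul_assoc] at this
  exact sub_ne_zero.mpr this.symm

lemma qPoch_ne_zero {x q : ℂ} (hx : ∀ k : ℕ, 1 ≤ k → x * q ^ k ≠ 1) (n : ℕ) :
    qPoch (x * q) q n ≠ 0 :=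
  Finset.prod_ne_zero_iff.mpr fun i _ => one_sub_mul_pow_ne_zero hx i

lemma pow_ne_one_of_norm_lt_one {q : ℂ} (hq : ‖q‖ < 1) (k : ℕ) (hk : 1 ≤ k) :
    q ^ k ≠ 1 := by
  intro h
  have h' : ‖q‖ ^ k = 1 := by rw [← norm_pow, h, norm_one]
  exact (pow_lt_one₀ (norm_nonneg q) hq (by omega)).ne h'

lemma one_sub_self_mul_pow_ne_zero {q : ℂ} (hq : ‖q‖ < 1) (n : ℕ) : 1 - q * q ^ n ≠ 0 := by
  simpa using one_sub_mul_pow_ne_zero (x := 1) (q := q)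
    (by simpa using pow_ne_one_of_norm_lt_one hq) n

lemma qPoch_self_ne_zero {q : ℂ} (hq : ‖q‖ < 1) (n : ℕ) : qPoch q q n ≠ 0 :=
  Finset.prod_ne_zero_iff.mpr fun i _ => one_sub_self_mul_pow_ne_zero hq i

lemma tendsto_one_sub_mul_pow {q : ℂ} (hq : ‖q‖ < 1) (a : ℂ) :
    Tendsto (fun k : ℕ => 1 - a * q ^ k) atTop (𝓝 1) := by
  simpa using tendsto_const_nhds.sub
    ((tendsto_pow_atTop_nhds_zero_of_norm_lt_one hq).const_mul a)

lemma summable_norm_of_succ_eq_mul {f g : ℕ → ℂ} (h : ∀ k, f (k + 1) = g k * f k)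
    (hg : Tendsto g atTop (𝓝 0)) : Summable fun k => ‖f k‖ := by
  apply summable_of_ratio_norm_eventually_le (r := 1 / 2) (by norm_num)
  have hg' : ∀ᶠ k in atTop, ‖g k‖ < 1 / 2 :=
    (tendsto_zero_iff_norm_tendsto_zero.mp hg).eventually_lt_const (by norm_num)
  filter_upwards [hg'] with k hk
  rw [norm_norm, norm_norm, h, norm_mul]
  gcongr

/-- The finite form: a limiting case of the `q`-Chu–Vandermonde sum. -/
lemma sum_antidiagonal_qPoch {q : ℂ} (hq : ‖q‖ < 1) (n : ℕ) :
    ∀ x : ℂ, (∀ k : ℕ, 1 ≤ k → x * q ^ k ≠ 1) →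
    ∑ p ∈ antidiagonal n,
      x ^ p.1 * q ^ (p.1 * p.1) / (qPoch q q p.1 * qPoch q q p.2 * qPoch (x * q) q p.1)
      = 1 / (qPoch q q n * qPoch (x * q) q n) := by
  induction n with
  | zero => intro x _; simp [qPoch_zero]
  | succ n ih =>
    intro x hx
    have hxq : ∀ k : ℕ, 1 ≤ k → x * q * q ^ k ≠ 1 := fun k hk => by
      have := hx (k + 1) (by omega)
      rwa [pow_succ', ← mul_assoc] at this
    have hx1 : 1 - x * q ≠ 0 := by simpa using one_sub_mul_pow_ne_zero hx 0
    have hn := one_sub_self_mul_pow_ne_zero hq n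
    set f : ℕ × ℕ → ℂ := fun p =>
      x ^ p.1 * q ^ (p.1 * p.1) / (qPoch q q p.1 * qPoch q q p.2 * qPoch (x * q) q p.1)
      with hf
    have hsplit : (1 - q * q ^ n) * ∑ p ∈ antidiagonal (n + 1), f p
        = ∑ p ∈ antidiagonal (n + 1), (1 - q ^ p.2) * f p
          + ∑ p ∈ antidiagonal (n + 1), q ^ p.2 * (1 - q ^ p.1) * f p := by
      rw [Finset.mul_sum, ← Finset.sum_add_distrib]
      refine Finset.sum_congr rfl fun p hp => ?_
      rw [← pow_succ', ← mem_antidiagonal.mp hp, pow_add]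
      ring
    have hfirst : ∑ p ∈ antidiagonal (n + 1), (1 - q ^ p.2) * f p
        = 1 / (qPoch q q n * qPoch (x * q) q n) := by
      rw [Finset.Nat.sum_antidiagonal_succ', ← ih x hx]
      simp only [pow_zero, sub_self, zero_mul, zero_add, hf]
      refine Finset.sum_congr rfl fun p _ => ?_
      have h2 := one_sub_self_mul_pow_ne_zero hq p.2
      have h3 := qPoch_self_ne_zero hq p.1
      have h4 := qPoch_self_ne_zero hq p.2
      have h5 := qPoch_ne_zero hx p.1
      rw [qPoch_succ, pow_succ']
      field_simp
    have hsecond : ∑ p ∈ antidiagonal (n + 1), q ^ p.2 * (1 - q ^ p.1) * f p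
        = x * q ^ (n + 1) / (1 - x * q) * (1 / (qPoch q q n * qPoch (x * q * q) q n)) := by
      rw [Finset.Nat.sum_antidiagonal_succ, ← ih (x * q) hxq, Finset.mul_sum]
      simp only [pow_zero, sub_self, mul_zero, zero_mul, zero_add, hf]
      refine Finset.sum_congr rfl fun p hp => ?_
      have h2 := one_sub_self_mul_pow_ne_zero hq p.1
      have h3 := qPoch_self_ne_zero hq p.1
      have h4 := qPoch_self_ne_zero hq p.2
      have h5 := qPoch_ne_zero hxq p.1
      rw [qPoch_succ, qPoch_succ', pow_succ' q p.1, ← mem_antidiagonal.mp hp]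
      field_simp
      ring
    have h3 := qPoch_self_ne_zero hq n
    have h5 := qPoch_ne_zero hx n
    have h6 := qPoch_ne_zero hxq n
    have h7 := one_sub_mul_pow_ne_zero hx n
    have h8 : (1 - x * q) * qPoch (x * q * q) q n = qPoch (x * q) q n * (1 - x * q * q ^ n) := by
      rw [← qPoch_succ, qPoch_succ']
    apply mul_left_cancel₀ hn
    rw [hsplit, hfirst, hsecond, div_mul_div_comm, mul_left_comm (1 - x * q), h8, qPoch_succ,
      qPoch_succ]
    field_simp
    ring

/-- The general term of Euler's expansion of `(zq;q)_∞`. -/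
noncomputable def eulerTerm (q z : ℂ) (m : ℕ) : ℂ :=
  (-z) ^ m * q ^ (m * (m + 1) / 2) / qPoch q q m

lemma eulerTerm_zero (q z : ℂ) : eulerTerm q z 0 = 1 := by simp [eulerTerm, qPoch_zero]

lemma eulerTerm_mul (q z w : ℂ) (m : ℕ) : eulerTerm q (z * w) m = w ^ m * eulerTerm q z m := by
  rw [eulerTerm, eulerTerm, ← neg_mul, mul_pow]
  ring

lemma eulerTerm_succ (q z : ℂ) (m : ℕ) :
    eulerTerm q z (m + 1) = -z * q ^ (m + 1) / (1 - q * q ^ m) * eulerTerm q z m := by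
  rw [eulerTerm, eulerTerm, triangle_succ, qPoch_succ, div_mul_div_comm, mul_comm (qPoch q q m)]
  ring

lemma summable_norm_eulerTerm {q : ℂ} (hq : ‖q‖ < 1) (z : ℂ) :
    Summable fun m => ‖eulerTerm q z m‖ := by
  refine summable_norm_of_succ_eq_mul (eulerTerm_succ q z) ?_
  simpa [Pi.div_def] using (((tendsto_pow_atTop_nhds_zero_of_norm_lt_one hq).comp
    (tendsto_add_atTop_nat 1)).const_mul (-z)).div (tendsto_one_sub_mul_pow hq q) one_ne_zero

lemma tsum_eulerTerm_eq_mul {q : ℂ} (hq : ‖q‖ < 1) (z : ℂ) :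
    ∑' m, eulerTerm q z m = (1 - z * q) * ∑' m, eulerTerm q (z * q) m := by
  have hz := (summable_norm_eulerTerm hq z).of_norm
  have hzq := (summable_norm_eulerTerm hq (z * q)).of_norm
  have hdiff : ∑' m, eulerTerm q z m - ∑' m, eulerTerm q (z * q) m
      = -(z * q) * ∑' m, eulerTerm q (z * q) m := by
    rw [← hz.tsum_sub hzq, (hz.sub hzq).tsum_eq_zero_add, ← tsum_mul_left, eulerTerm_zero,
      eulerTerm_zero, sub_self, zero_add]
    refine tsum_congr fun m => ?_
    have := one_sub_self_mul_pow_ne_zero hq m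
    rw [eulerTerm_mul, eulerTerm_mul, eulerTerm_succ]
    field_simp
    ring
  linear_combination hdiff

lemma tsum_eulerTerm_eq_qPoch_mul {q : ℂ} (hq : ‖q‖ < 1) (z : ℂ) (n : ℕ) :
    ∑' m, eulerTerm q z m = qPoch (z * q) q n * ∑' m, eulerTerm q (z * q ^ n) m := by
  induction n with
  | zero => simp [qPoch_zero]
  | succ n ih =>
    rw [ih, tsum_eulerTerm_eq_mul hq (z * q ^ n), qPoch_succ, pow_succ, ← mul_assoc z]
    ring

lemma tendsto_qPoch {q : ℂ} (hq : ‖q‖ < 1) (a : ℂ) :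
    Tendsto (qPoch a q) atTop (𝓝 (qPochInf a q)) := by
  have hs : Summable fun i : ℕ => ‖-(a * q ^ i)‖ := by
    simpa using (summable_geometric_of_lt_one (norm_nonneg q) hq).mul_left ‖a‖
  have := (multipliable_one_add_of_summable hs).hasProd.tendsto_prod_nat
  simp only [← sub_eq_add_neg] at this
  exact this

/-- Euler's expansion of `(zq;q)_∞`. -/
lemma tsum_eulerTerm {q : ℂ} (hq : ‖q‖ < 1) (z : ℂ) :
    ∑' m, eulerTerm q z m = qPochInf (z * q) q := by
  have hlim : Tendsto (fun n : ℕ => ∑' m, eulerTerm q (z * q ^ n) m) atTop (𝓝 1) := by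
    have h1 : ∑' m, (if m = 0 then (1 : ℂ) else 0) = 1 := by simp
    rw [← h1]
    refine tendsto_tsum_of_dominated_convergence (summable_norm_eulerTerm hq z) ?_ ?_
    · intro m
      rcases m with _ | m
      · simp [eulerTerm_zero]
      · simp only [eulerTerm_mul]
        simpa using ((tendsto_pow_atTop_nhds_zero_of_norm_lt_one hq).pow (m + 1)).mul_const
          (eulerTerm q z (m + 1))
    · refine Eventually.of_forall fun n m => ?_
      rw [eulerTerm_mul, norm_mul, norm_pow, norm_pow]
      exact mul_le_of_le_one_left (norm_nonneg _)
        (pow_le_one₀ (by positivity) (pow_le_one₀ (norm_nonneg q) hq.le))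
  have := (tendsto_qPoch hq (z * q)).mul hlim
  simp only [← tsum_eulerTerm_eq_qPoch_mul hq z, mul_one] at this
  exact tendsto_nhds_unique tendsto_const_nhds this

lemma summable_norm_left {q : ℂ} (hq : ‖q‖ < 1) (x y : ℂ) :
    Summable fun k : ℕ =>
      ‖(-y) ^ k * q ^ (k * (k + 1) / 2) / (qPoch q q k * qPoch (x * q) q k)‖ := by
  refine summable_norm_of_succ_eq_mul
    (g := fun k => -y * q ^ (k + 1) / ((1 - q * q ^ k) * (1 - x * q * q ^ k))) ?_ ?_
  · intro k
    rw [triangle_succ, qPoch_succ, qPoch_succ, div_mul_div_comm]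
    congr 1 <;> ring
  · simpa [Pi.div_def] using (((tendsto_pow_atTop_nhds_zero_of_norm_lt_one hq).comp
      (tendsto_add_atTop_nat 1)).const_mul (-y)).div
      ((tendsto_one_sub_mul_pow hq q).mul (tendsto_one_sub_mul_pow hq (x * q)))
      (by norm_num)

lemma summable_norm_right {q : ℂ} (hq : ‖q‖ < 1) (x y w : ℂ) :
    Summable fun k : ℕ => ‖(-w) ^ k * q ^ (k * k) * q ^ (k * (k + 1) / 2) /
      (qPoch (x * q) q k * qPoch (y * q) q k * qPoch q q k)‖ := by
  refine summable_norm_of_succ_eq_mul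
    (g := fun k => -w * q ^ (k + 1) * (q ^ k * q ^ (k + 1)) /
      ((1 - x * q * q ^ k) * (1 - y * q * q ^ k) * (1 - q * q ^ k))) ?_ ?_
  · intro k
    rw [triangle_succ, qPoch_succ, qPoch_succ, qPoch_succ, div_mul_div_comm]
    congr 1 <;> ring
  · have h0 := tendsto_pow_atTop_nhds_zero_of_norm_lt_one hq
    have h1 := h0.comp (tendsto_add_atTop_nat 1)
    simpa [Pi.div_def] using ((h1.const_mul (-w)).mul (h0.mul h1)).div
      (((tendsto_one_sub_mul_pow hq (x * q)).mul (tendsto_one_sub_mul_pow hq (y * q))).mul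
        (tendsto_one_sub_mul_pow hq q)) (by norm_num)

lemma tsum_left_eq_qPochInf_mul_tsum {q x y : ℂ} (hq : ‖q‖ < 1)
    (hx : ∀ k : ℕ, 1 ≤ k → x * q ^ k ≠ 1) (hy : ∀ k : ℕ, 1 ≤ k → y * q ^ k ≠ 1) :
    ∑' k : ℕ, (-y) ^ k * q ^ (k * (k + 1) / 2) / (qPoch q q k * qPoch (x * q) q k)
      = qPochInf (y * q) q * ∑' k : ℕ, (-(x * y)) ^ k * q ^ (k * k) * q ^ (k * (k + 1) / 2) /
          (qPoch (x * q) q k * qPoch (y * q) q k * qPoch q q k) := by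
  set u : ℕ → ℂ := fun k => (-(x * y)) ^ k * q ^ (k * k) * q ^ (k * (k + 1) / 2) /
    (qPoch (x * q) q k * qPoch q q k) with hu
  have hu_summable : Summable fun k => ‖u k‖ := by
    have h1 : ∀ k, qPoch (0 * q) q k = 1 := by simp [qPoch]
    simpa only [h1, mul_one] using summable_norm_right hq x 0 (x * y)
  set F : ℕ × ℕ → ℂ := fun p => u p.1 * eulerTerm q (y * q ^ p.1) p.2 with hF
  have hF_summable : Summable F := by
    refine Summable.of_norm_bounded
      (hu_summable.mul_of_nonneg (summable_norm_eulerTerm hq y)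
        (fun _ => norm_nonneg _) (fun _ => norm_nonneg _)) fun p => ?_
    rw [hF, norm_mul, eulerTerm_mul, norm_mul, norm_pow, norm_pow]
    gcongr
    exact mul_le_of_le_one_left (norm_nonneg _)
        (pow_le_one₀ (by positivity) (pow_le_one₀ (norm_nonneg q) hq.le))
  have hrow : ∀ k : ℕ, qPochInf (y * q) q *
      ((-(x * y)) ^ k * q ^ (k * k) * q ^ (k * (k + 1) / 2) /
          (qPoch (x * q) q k * qPoch (y * q) q k * qPoch q q k)) = ∑' m, F (k, m) := by
    intro k
    have h1 := qPoch_ne_zero hy k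
    simp only [hF]
    rw [tsum_mul_left, ← tsum_eulerTerm hq, tsum_eulerTerm_eq_qPoch_mul hq y k, hu]
    field_simp
  have hdiag : ∀ n : ℕ, (-y) ^ n * q ^ (n * (n + 1) / 2) / (qPoch q q n * qPoch (x * q) q n)
      = ∑ p ∈ antidiagonal n, F p := by
    intro n
    rw [div_eq_mul_one_div, ← sum_antidiagonal_qPoch hq n x hx, Finset.mul_sum]
    refine Finset.sum_congr rfl fun p hp => ?_
    rw [← mem_antidiagonal.mp hp, triangle_add]
    simp only [hF, hu, eulerTerm]
    rw [← neg_mul y, mul_pow (-y), ← pow_mul, show -(x * y) = x * -y by ring, mul_pow x]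
    simp only [pow_add]
    ring
  rw [← tsum_mul_left, tsum_congr hrow, tsum_congr hdiag, ← hF_summable.tsum_prod,
    ← Finset.HasAntidiagonal.sigmaAntidiagonalEquivProd.tsum_eq F]
  refine Eq.trans ?_ (Finset.HasAntidiagonal.sigmaAntidiagonalEquivProd.summable_iff.mpr hF_summable).tsum_sigma.symm
  refine tsum_congr fun n => ?_
  rw [tsum_fintype, ← Finset.sum_coe_sort]
  rfl

/-- Ismail's identity (Theorem 1): for `|q| < 1` with `atq^k ≠ 1`, `btq^k ≠ 1` for `k ≥ 1`,
`((atq;q)_∞/(q;q)_∞) Σ_k (−bt)^k q^{k(k+1)/2} / ((q;q)_k (atq;q)_k)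
  = ((atq,btq;q)_∞/(q;q)_∞) Σ_k (−1)^k (abt²q)^k q^{k(3k−1)/2} / ((atq,btq,q;q)_k)`,
with all series converging absolutely. -/
theorem stmt0 (q a b t : ℂ) (hq : ‖q‖ < 1)
    (ha : ∀ k : ℕ, 1 ≤ k → a * t * q ^ k ≠ 1)
    (hb : ∀ k : ℕ, 1 ≤ k → b * t * q ^ k ≠ 1) :
    Summable (fun k : ℕ =>
      ‖(-(b * t)) ^ k * q ^ (k * (k + 1) / 2) / (qPoch q q k * qPoch (a * t * q) q k)‖) ∧
    Summable (fun k : ℕ =>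
      ‖(-1 : ℂ) ^ k * (a * b * t ^ 2 * q) ^ k * q ^ (k * (3 * k - 1) / 2) /
        (qPoch (a * t * q) q k * qPoch (b * t * q) q k * qPoch q q k)‖) ∧
    qPochInf (a * t * q) q / qPochInf q q *
        ∑' k : ℕ, (-(b * t)) ^ k * q ^ (k * (k + 1) / 2) /
          (qPoch q q k * qPoch (a * t * q) q k)
      = qPochInf (a * t * q) q * qPochInf (b * t * q) q / qPochInf q q *
        ∑' k : ℕ, (-1 : ℂ) ^ k * (a * b * t ^ 2 * q) ^ k * q ^ (k * (3 * k - 1) / 2) /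
          (qPoch (a * t * q) q k * qPoch (b * t * q) q k * qPoch q q k) := by
  have hright : ∀ k : ℕ, (-1 : ℂ) ^ k * (a * b * t ^ 2 * q) ^ k * q ^ (k * (3 * k - 1) / 2)
      = (-(a * t * (b * t))) ^ k * q ^ (k * k) * q ^ (k * (k + 1) / 2) := by
    intro k
    rw [mul_assoc _ (q ^ (k * k)), ← pow_add, ← pentagonal_add_self, pow_add,
      show -(a * t * (b * t)) = -1 * (a * b * t ^ 2) by ring, mul_pow (-1 : ℂ), mul_pow _ q]
    ring
  simp only [hright]
  refine ⟨summable_norm_left hq _ _, summable_norm_right hq _ _ _, ?_⟩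
  rw [tsum_left_eq_qPochInf_mul_tsum hq ha hb]
  ring
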